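/- Let p be a prime with p ≡ 2 (mod 3) and let M ∈ G(p) ⊆ GL₂(F_p). Then every eigenvalue of M (viewed in F_{p²}) is a cube in F_{p²}^×. -/

import Mathlib

open Matrix

noncomputable section

/-- The least positive integer which is a quadratic non-residue modulo `p`. -/
def leastNonResidue (p : ℕ) : ℕ :=
  sInf {n : ℕ | 0 < n ∧ ¬∃ x : ZMod p, x ^ 2 = (n : ZMod p)}

/-- `ε ∈ 𝔽_p`: the reduction mod `p` of the least positive quadratic non-residue. -/
def nsEps (p : ℕ) : ZMod p := (leastNonResidue p : ZMod p)

/-- The non-split Cartan subgroup `C_ns(p) ⊆ GL₂(𝔽_p)` (as a set): invertible matrices of the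
form `[[a, εb], [b, a]]`.  (Invertibility forces `(a, b) ≠ (0, 0)`.) -/
def Cns (p : ℕ) : Set (GL (Fin 2) (ZMod p)) :=
  {M | ∃ a b : ZMod p, (M : Matrix (Fin 2) (Fin 2) (ZMod p)) = !![a, nsEps p * b; b, a]}

/-- The subgroup `G(p) = {a³ : a ∈ C_ns(p)} ∪ {diag(1,-1)·a³ : a ∈ C_ns(p)}` of `GL₂(𝔽_p)`
(as a set). -/
def Gset (p : ℕ) : Set (GL (Fin 2) (ZMod p)) :=
  {M | (∃ a ∈ Cns p, M = a ^ 3) ∨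
    ∃ a ∈ Cns p, (M : Matrix (Fin 2) (Fin 2) (ZMod p)) =
      !![1, 0; 0, -1] * ((a : Matrix (Fin 2) (Fin 2) (ZMod p)) ^ 3)}

end

theorem sq_aux (p : ℕ) [Fact p.Prime] (x : ZMod p) :
    ∃ s : GaloisField p 2, s ^ 2 = algebraMap (ZMod p) (GaloisField p 2) x := by
  have hp : p.Prime := Fact.out
  have key : IsSquare (algebraMap (ZMod p) (GaloisField p 2) x) := by
    have hc : ringChar (GaloisField p 2) = p := ringChar.eq _ p
    haveI : Fintype (GaloisField p 2) := Fintype.ofFinite _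
    by_cases h2 : p = 2
    · exact FiniteField.isSquare_of_char_two (hc.trans h2) _
    by_cases hx : x = 0
    · simp [hx]
    have hx' : algebraMap (ZMod p) (GaloisField p 2) x ≠ 0 := by
      simpa using hx
    rw [FiniteField.isSquare_iff (by rw [hc]; exact h2) hx', ← Nat.card_eq_fintype_card,
      GaloisField.card p 2 (by norm_num)]
    obtain ⟨k, hk⟩ := hp.odd_of_ne_two h2
    have h3 : p ^ 2 / 2 = (p - 1) * (k + 1) := by
      have h4 : p - 1 = 2 * k := by omega
      have : p ^ 2 = 2 * (2 * k * (k + 1)) + 1 := by rw [hk]; ring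
      rw [h4]
      omega
    rw [h3, pow_mul, ← map_pow, ZMod.pow_card_sub_one_eq_one hx]
    simp
  obtain ⟨s, hs⟩ := key
  exact ⟨s, by rw [hs, sq]⟩

/-- Every eigenvalue (in `𝔽_{p²}`, i.e. every root of the characteristic polynomial
`t² - tr(M)·t + det(M)`) of an element `M ∈ G(p)` is a cube in `𝔽_{p²}^×`, where `p ≡ 2 (mod 3)`
is prime and `𝔽_{p²}` is realised as `GaloisField p 2`. -/
theorem eigenvalue_of_mem_Gset_is_cube (p : ℕ) [Fact p.Prime] (hp3 : p % 3 = 2)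
    (M : GL (Fin 2) (ZMod p)) (hM : M ∈ Gset p) (t : GaloisField p 2)
    (ht : t ^ 2
        - algebraMap (ZMod p) (GaloisField p 2)
            (Matrix.trace (M : Matrix (Fin 2) (Fin 2) (ZMod p))) * t
        + algebraMap (ZMod p) (GaloisField p 2)
            ((M : Matrix (Fin 2) (Fin 2) (ZMod p)).det) = 0) :
    ∃ u : GaloisField p 2, u ≠ 0 ∧ u ^ 3 = t := by
  have hdet : (M : Matrix (Fin 2) (Fin 2) (ZMod p)).det ≠ 0 :=
    ((Matrix.isUnit_iff_isUnit_det _).1 M.isUnit).ne_zero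
  have ht0 : t ≠ 0 := by
    rintro rfl
    apply hdet
    simpa using ht
  suffices h : ∃ u : GaloisField p 2, u ^ 3 = t by
    obtain ⟨u, hu⟩ := h
    refine ⟨u, ?_, hu⟩
    rintro rfl
    exact ht0 (by rw [← hu]; simp)
  rcases hM with ⟨A, ⟨a, b, hA⟩, hMA⟩ | ⟨A, ⟨a, b, hA⟩, hMA⟩
  · obtain ⟨s, hs⟩ := sq_aux p (nsEps p)
    have hM' : (M : Matrix (Fin 2) (Fin 2) (ZMod p)) = !![a, nsEps p * b; b, a] ^ 3 := by
      rw [hMA, ← hA]; simp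
    rw [hM', Matrix.det_pow, Matrix.det_fin_two, Matrix.trace_fin_two] at ht
    simp only [pow_succ, pow_zero, one_mul, Matrix.mul_fin_two, Matrix.of_apply,
      Matrix.cons_val', Matrix.cons_val_zero, Matrix.cons_val_one,
      map_add, map_sub, map_mul, ← hs] at ht
    set α := algebraMap (ZMod p) (GaloisField p 2) a
    set β := algebraMap (ZMod p) (GaloisField p 2) b
    have : (t - (α + β * s) ^ 3) * (t - (α - β * s) ^ 3) = 0 := by
      rw [← ht]; ring
    rcases mul_eq_zero.1 this with h | h
    · exact ⟨_, (sub_eq_zero.1 h).symm⟩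
    · exact ⟨_, (sub_eq_zero.1 h).symm⟩
  · obtain ⟨n, hn⟩ := sq_aux p (A : Matrix (Fin 2) (Fin 2) (ZMod p)).det
    have htr : Matrix.trace (M : Matrix (Fin 2) (Fin 2) (ZMod p)) = 0 := by
      rw [hMA, hA, Matrix.trace_fin_two]
      simp only [pow_succ, pow_zero, one_mul, Matrix.mul_fin_two, Matrix.of_apply,
        Matrix.cons_val', Matrix.cons_val_zero, Matrix.cons_val_one]
      ring
    have hd : (M : Matrix (Fin 2) (Fin 2) (ZMod p)).det
        = - (A : Matrix (Fin 2) (Fin 2) (ZMod p)).det ^ 3 := by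
      rw [hMA, Matrix.det_mul, Matrix.det_pow]
      simp [Matrix.det_fin_two_of]
    rw [htr, hd, map_neg, map_pow, ← hn, map_zero] at ht
    have : (t - n ^ 3) * (t - (-n) ^ 3) = 0 := by
      rw [← ht]; ring
    rcases mul_eq_zero.1 this with h | h
    · exact ⟨_, (sub_eq_zero.1 h).symm⟩
    · exact ⟨_, (sub_eq_zero.1 h).symm⟩
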